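/- The square tetromino P₄,₄ = {(0,0),(0,1),(1,0),(1,1)} has threshold sequence (0,3,5,∞): it is a (1,0)-winner, a (1,1)-loser, a (2,3)-winner, a (2,4)-loser, a (3,5)-winner, a (3,6)-loser, and an (n,b)-winner for every n ≥ 4 and every b ∈ ℕ. -/

import Mathlib

/-- Cells of the square board. -/
abbrev Cell : Type := ℤ × ℤ

/-- Two cells are adjacent if they differ by `(±1,0)` or `(0,±1)`. -/
def Adjacent (p q : Cell) : Prop :=
  (p.1 - q.1).natAbs + (p.2 - q.2).natAbs = 1

/-- A polyomino is a finite nonempty set of cells that is connected under adjacency. -/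
def IsPolyomino (A : Finset Cell) : Prop :=
  A.Nonempty ∧ ∀ p ∈ A, ∀ q ∈ A,
    Relation.ReflTransGen (fun u v => u ∈ A ∧ v ∈ A ∧ Adjacent u v) p q

/-- A symmetry of the square lattice: a translation composed with a rotation by a
multiple of 90 degrees and possibly a reflection. -/
def IsSquareSymmetry (f : Cell → Cell) : Prop :=
  ∃ (e₁ e₂ : ℤ) (s : Bool) (t : Cell),
    (e₁ = 1 ∨ e₁ = -1) ∧ (e₂ = 1 ∨ e₂ = -1) ∧
    ∀ p : Cell, f p =
      if s then (e₁ * p.2 + t.1, e₂ * p.1 + t.2)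
      else (e₁ * p.1 + t.1, e₂ * p.2 + t.2)

/-- `P` is a placement of the polyomino `A`: the image of `A` under a symmetry
of the square lattice. -/
def IsPlacement (A : Finset Cell) (P : Set Cell) : Prop :=
  ∃ f : Cell → Cell, IsSquareSymmetry f ∧ P = f '' (↑A : Set Cell)

/-- The maker's move on his `n`-th turn (`0`-indexed), given his strategy `σ`
(a function of the list of the breaker's previous moves, which together with `σ`
determines the whole history) and the breaker's sequence of moves `β`. -/
def makerMove (σ : List (Finset Cell) → Finset Cell) (β : ℕ → Finset Cell) (n : ℕ) :
    Finset Cell :=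
  σ ((List.range n).map β)

/-- The set of cells marked by the maker after his first `n` turns. -/
def makerMarks (σ : List (Finset Cell) → Finset Cell) (β : ℕ → Finset Cell) :
    ℕ → Finset Cell
  | 0 => ∅
  | n + 1 => makerMarks σ β n ∪ makerMove σ β n

/-- The set of cells marked by the breaker after her first `n` turns. -/
def breakerMarks (β : ℕ → Finset Cell) : ℕ → Finset Cell
  | 0 => ∅
  | n + 1 => breakerMarks β n ∪ β n

/-- The maker plays legally: on every turn he marks exactly `a` previously unmarked cells. -/
def MakerLegal (a : ℕ) (σ : List (Finset Cell) → Finset Cell) (β : ℕ → Finset Cell) : Prop :=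
  ∀ n, (makerMove σ β n).card = a ∧
    Disjoint (makerMove σ β n) (makerMarks σ β n ∪ breakerMarks β n)

/-- The breaker plays legally: on every turn she marks exactly `b` previously unmarked
cells (on turn `n` she moves after the maker, so she must avoid `makerMarks σ β (n+1)`). -/
def BreakerLegal (b : ℕ) (σ : List (Finset Cell) → Finset Cell) (β : ℕ → Finset Cell) : Prop :=
  ∀ n, (β n).card = b ∧ Disjoint (β n) (makerMarks σ β (n + 1) ∪ breakerMarks β n)

/-- `A` is an `(a,b)`-winner: the maker has a winning strategy in the weak `(a,b)`
achievement game with goal `A`, i.e. a strategy that always plays legally against any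
legal breaker play and eventually marks all cells of some placement of `A`. -/
def IsWinner (A : Finset Cell) (a b : ℕ) : Prop :=
  ∃ σ : List (Finset Cell) → Finset Cell, ∀ β : ℕ → Finset Cell,
    BreakerLegal b σ β →
      MakerLegal a σ β ∧
        ∃ n, ∃ P : Set Cell, IsPlacement A P ∧ P ⊆ ↑(makerMarks σ β n)

/-- The square tetromino `P₄,₄`. -/
def P44 : Finset Cell := {(0, 0), (0, 1), (1, 0), (1, 1)}

open Classical in
theorem pad_exists (F X : Finset Cell) (a : ℕ) (hX : X.card ≤ a) (hd : Disjoint X F) :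
    ∃ X' : Finset Cell, X ⊆ X' ∧ X'.card = a ∧ Disjoint X' F := by
  have hinf : ((↑(F ∪ X) : Set Cell)ᶜ).Infinite := (F ∪ X).finite_toSet.infinite_compl
  obtain ⟨t, ht, hc⟩ := hinf.exists_subset_card_eq (a - X.card)
  have h1 : ∀ x ∈ t, x ∉ F ∧ x ∉ X := by
    intro x hx
    have := ht hx
    simpa using this
  refine ⟨X ∪ t, Finset.subset_union_left, ?_, ?_⟩
  · rw [Finset.card_union_of_disjoint, hc]
    · omega
    · rw [Finset.disjoint_right]
      exact fun x hx => (h1 x hx).2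
  · rw [Finset.disjoint_union_left]
    refine ⟨hd, ?_⟩
    rw [Finset.disjoint_left]
    exact fun x hx => (h1 x hx).1

/-- The cells `M` contain a placement. -/
def HasP (M : Finset Cell) : Prop := ∃ P : Set Cell, IsPlacement P44 P ∧ P ⊆ ↑M

theorem hasP_of (M : Finset Cell) (x y e f : ℤ) (he : e = 1 ∨ e = -1) (hf : f = 1 ∨ f = -1)
    (h1 : (x, y) ∈ M) (h2 : (x, y + f) ∈ M) (h3 : (x + e, y) ∈ M) (h4 : (x + e, y + f) ∈ M) :
    HasP M := by
  refine ⟨_, ⟨fun p => (e * p.1 + x, f * p.2 + y), ⟨e, f, false, (x, y), he, hf, ?_⟩, rfl⟩, ?_⟩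
  · intro p; simp
  · rintro q ⟨p, hp, rfl⟩
    simp only [P44, Finset.coe_insert, Finset.coe_singleton, Set.mem_insert_iff,
      Set.mem_singleton_iff] at hp
    rcases hp with rfl | rfl | rfl | rfl <;> simp [add_comm] <;>
      simpa [add_comm] using by assumption

theorem hasP_sq (M : Finset Cell) (h : HasP M) :
    ∃ x y : ℤ, (x, y) ∈ M ∧ (x, y + 1) ∈ M ∧ (x + 1, y) ∈ M ∧ (x + 1, y + 1) ∈ M := by
  obtain ⟨P, ⟨f, ⟨e₁, e₂, s, t, h1, h2, hf⟩, rfl⟩, hs⟩ := h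
  have a1 : f (0, 0) ∈ M := hs ⟨_, by simp [P44], rfl⟩
  have a2 : f (0, 1) ∈ M := hs ⟨_, by simp [P44], rfl⟩
  have a3 : f (1, 0) ∈ M := hs ⟨_, by simp [P44], rfl⟩
  have a4 : f (1, 1) ∈ M := hs ⟨_, by simp [P44], rfl⟩
  rw [hf] at a1 a2 a3 a4
  obtain ⟨t1, t2⟩ := t
  refine ⟨if e₁ = 1 then t1 else t1 - 1, if e₂ = 1 then t2 else t2 - 1, ?_⟩
  have u1 : -1 + t1 = t1 - 1 := by ring
  have u2 : -1 + t2 = t2 - 1 := by ring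
  have u3 : 1 + t1 = t1 + 1 := by ring
  have u4 : 1 + t2 = t2 + 1 := by ring
  cases s <;> rcases h1 with rfl | rfl <;> rcases h2 with rfl | rfl <;>
    simp [u1, u2, u3, u4] at a1 a2 a3 a4 ⊢ <;> simp [*]

/-- Maker, to move, can win within `n` turns. -/
def WinIn (a b : ℕ) : ℕ → Finset Cell → Finset Cell → Prop
  | 0, M, _ => HasP M
  | n + 1, M, B => ∃ X : Finset Cell, X.card = a ∧ Disjoint X (M ∪ B) ∧
      ∀ Y : Finset Cell, Y.card = b → Disjoint Y (M ∪ X ∪ B) → WinIn a b n (M ∪ X) (B ∪ Y)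

theorem mk_exists (a b : ℕ) (s : ℕ × Finset Cell × Finset Cell) :
    ∃ X : Finset Cell, X.card = a ∧ Disjoint X (s.2.1 ∪ s.2.2) ∧
      ∀ n, s.1 = n + 1 → WinIn a b s.1 s.2.1 s.2.2 →
      ∀ Y : Finset Cell, Y.card = b → Disjoint Y (s.2.1 ∪ X ∪ s.2.2) →
        WinIn a b n (s.2.1 ∪ X) (s.2.2 ∪ Y) := by
  obtain ⟨k, M, B⟩ := s
  cases k with
  | zero =>
    obtain ⟨X, -, h1, h2⟩ := pad_exists (M ∪ B) ∅ a (by simp) (by simp)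
    exact ⟨X, h1, h2, fun n hn => by simp at hn⟩
  | succ k =>
    by_cases hw : WinIn a b (k + 1) M B
    · obtain ⟨X, h1, h2, h3⟩ := hw
      refine ⟨X, h1, h2, fun n hn _ => ?_⟩
      obtain rfl : k = n := by simpa using hn
      exact h3
    · obtain ⟨X, -, h1, h2⟩ := pad_exists (M ∪ B) ∅ a (by simp) (by simp)
      exact ⟨X, h1, h2, fun n hn h => absurd h hw⟩

noncomputable def mkF (a b : ℕ) (s : ℕ × Finset Cell × Finset Cell) : Finset Cell :=
  (mk_exists a b s).choose

noncomputable def mkStep (a b : ℕ) (s : ℕ × Finset Cell × Finset Cell) (Y : Finset Cell) :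
    ℕ × Finset Cell × Finset Cell :=
  (s.1 - 1, s.2.1 ∪ mkF a b s, s.2.2 ∪ Y)

theorem winner_of (a b N : ℕ) (h : WinIn a b N ∅ ∅) : IsWinner P44 a b := by
  let σ : List (Finset Cell) → Finset Cell := fun l => mkF a b (l.foldl (mkStep a b) (N, ∅, ∅))
  refine ⟨σ, fun β hβ => ?_⟩
  have key : ∀ n, ((List.range n).map β).foldl (mkStep a b) (N, ∅, ∅) =
      (N - n, makerMarks σ β n, breakerMarks β n) := by
    intro n
    induction n with
    | zero => simp [makerMarks, breakerMarks]
    | succ n ih =>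
      rw [List.range_succ, List.map_append, List.foldl_append, ih]
      simp only [List.map_cons, List.map_nil, List.foldl_cons, List.foldl_nil, mkStep,
        makerMarks, breakerMarks, makerMove, σ, ih]
      simp only [Prod.mk.injEq, and_true]
      omega
  have mv : ∀ n, makerMove σ β n = mkF a b (N - n, makerMarks σ β n, breakerMarks β n) := by
    intro n
    rw [← key n]; rfl
  constructor
  · intro n
    rw [mv]
    have := (mk_exists a b (N - n, makerMarks σ β n, breakerMarks β n)).choose_spec
    exact ⟨this.1, this.2.1⟩
  · have main : ∀ n, n ≤ N → WinIn a b (N - n) (makerMarks σ β n) (breakerMarks β n) := by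
      intro n
      induction n with
      | zero => intro _; simpa [makerMarks, breakerMarks] using h
      | succ n ih =>
        intro hn
        have hs := (mk_exists a b (N - n, makerMarks σ β n, breakerMarks β n)).choose_spec.2.2
          (N - (n + 1)) (by simp only; omega) (ih (by omega)) (β n) (hβ n).1
        have hd := (hβ n).2
        simp only [makerMarks, mv] at hd
        have := hs hd
        simp only [makerMarks, breakerMarks, mv]
        exact this
    have := main N le_rfl
    rw [Nat.sub_self] at this
    exact ⟨N, this⟩

/-- Breaker framework -/
theorem br_exists (b : ℕ) (Inv : Finset Cell → Finset Cell → Prop)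
    (M X B : Finset Cell) :
    ∃ Y : Finset Cell, Y.card = b ∧ Disjoint Y (M ∪ X ∪ B) ∧
      ((∃ Y' : Finset Cell, Y'.card = b ∧ Disjoint Y' (M ∪ X ∪ B) ∧ Inv (M ∪ X) (B ∪ Y')) →
        Inv (M ∪ X) (B ∪ Y)) := by
  by_cases h : ∃ Y' : Finset Cell, Y'.card = b ∧ Disjoint Y' (M ∪ X ∪ B) ∧ Inv (M ∪ X) (B ∪ Y')
  · obtain ⟨Y, h1, h2, h3⟩ := h
    exact ⟨Y, h1, h2, fun _ => h3⟩
  · obtain ⟨Y, -, h1, h2⟩ := pad_exists (M ∪ X ∪ B) ∅ b (by simp) (by simp)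
    exact ⟨Y, h1, h2, fun h' => absurd h' h⟩

noncomputable def brG (b : ℕ) (Inv : Finset Cell → Finset Cell → Prop)
    (M X B : Finset Cell) : Finset Cell := (br_exists b Inv M X B).choose

noncomputable def brS (b : ℕ) (Inv : Finset Cell → Finset Cell → Prop)
    (σ : List (Finset Cell) → Finset Cell) :
    ℕ → List (Finset Cell) × Finset Cell × Finset Cell
  | 0 => ([], ∅, ∅)
  | n + 1 =>
    let s := brS b Inv σ n
    (s.1 ++ [brG b Inv s.2.1 (σ s.1) s.2.2], s.2.1 ∪ σ s.1,
      s.2.2 ∪ brG b Inv s.2.1 (σ s.1) s.2.2)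

theorem loser_of (a b : ℕ) (Inv : Finset Cell → Finset Cell → Prop)
    (h0 : Inv ∅ ∅) (hP : ∀ M B, Inv M B → ¬ HasP M)
    (hstep : ∀ M X B, Inv M B → X.card = a → Disjoint X (M ∪ B) →
      ∃ Y : Finset Cell, Y.card ≤ b ∧ Disjoint Y (M ∪ X ∪ B) ∧
        ∀ Y', Y ⊆ Y' → Disjoint Y' (M ∪ X ∪ B) → Inv (M ∪ X) (B ∪ Y')) :
    ¬ IsWinner P44 a b := by
  rintro ⟨σ, hσ⟩
  let β : ℕ → Finset Cell := fun n =>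
    brG b Inv (brS b Inv σ n).2.1 (σ (brS b Inv σ n).1) (brS b Inv σ n).2.2
  have key : ∀ n, brS b Inv σ n =
      ((List.range n).map β, makerMarks σ β n, breakerMarks β n) := by
    intro n
    induction n with
    | zero => simp [brS, makerMarks, breakerMarks]
    | succ n ih =>
      have e : β n = brG b Inv (brS b Inv σ n).2.1 (σ (brS b Inv σ n).1) (brS b Inv σ n).2.2 := rfl
      rw [List.range_succ, List.map_append, brS]
      simp only [makerMarks, breakerMarks, makerMove, List.map_cons, List.map_nil]
      rw [← e, ih]
  have eβ : ∀ n, β n = brG b Inv (makerMarks σ β n) (makerMove σ β n) (breakerMarks β n) := by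
    intro n
    have e : β n = brG b Inv (brS b Inv σ n).2.1 (σ (brS b Inv σ n).1) (brS b Inv σ n).2.2 := rfl
    rw [key] at e
    exact e
  have spec : ∀ n, _ := fun n =>
    (br_exists b Inv (makerMarks σ β n) (makerMove σ β n) (breakerMarks β n)).choose_spec
  have hleg : BreakerLegal b σ β := by
    intro n
    rw [eβ]
    exact ⟨(spec n).1, (spec n).2.1⟩
  obtain ⟨hm, n, hn⟩ := hσ β hleg
  have inv : ∀ n, Inv (makerMarks σ β n) (breakerMarks β n) := by
    intro n
    induction n with
    | zero => exact h0
    | succ n ih =>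
      obtain ⟨Y, c1, c2, c3⟩ := hstep _ _ _ ih (hm n).1 (hm n).2
      obtain ⟨Y', d1, d2, d3⟩ := pad_exists _ Y b c1 c2
      have := (spec n).2.2 ⟨Y', d2, d3, c3 Y' d1 d3⟩
      simp only [makerMarks, breakerMarks]
      rw [eβ n]
      exact this
  exact hP _ _ (inv n) hn

/-! ### (1,1) -/

def mate (c : Cell) : Cell := if (c.1 + c.2) % 2 = 0 then (c.1 + 1, c.2) else (c.1 - 1, c.2)

theorem mate_mate (c : Cell) : mate (mate c) = c := by
  obtain ⟨x, y⟩ := c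
  unfold mate
  split_ifs with h1 h2 h2 <;> simp at * <;> omega

theorem mate_ne (c : Cell) : mate c ≠ c := by
  obtain ⟨x, y⟩ := c
  unfold mate
  split_ifs with h1 <;> simp

theorem loser11 : ¬ IsWinner P44 1 1 := by
  apply loser_of 1 1 (fun M B => Disjoint M B ∧ ∀ c ∈ M, mate c ∈ B)
  · simp
  · rintro M B ⟨hd, hm⟩ hP
    obtain ⟨x, y, h1, h2, h3, h4⟩ := hasP_sq M hP
    rw [Finset.disjoint_left] at hd
    by_cases h : (x + y) % 2 = 0
    · have := hm _ h1
      simp only [mate, h, if_true] at this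
      exact hd h3 this
    · have := hm _ h2
      have h' : (x + (y + 1)) % 2 = 0 := by omega
      simp only [mate, h', if_true] at this
      exact hd h4 this
  · rintro M X B ⟨hd, hm⟩ hX hdX
    obtain ⟨c, rfl⟩ := Finset.card_eq_one.1 hX
    have hc : c ∉ M ∧ c ∉ B := by simpa using hdX
    have hcM : mate c ∉ M := by
      intro h
      have := hm _ h
      rw [mate_mate] at this
      exact hc.2 this
    have hne := mate_ne c
    refine ⟨{mate c} \ B, ?_, ?_, ?_⟩
    · exact (Finset.card_le_card Finset.sdiff_subset).trans (by simp)
    · rw [Finset.disjoint_left]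
      intro z hz
      simp only [Finset.mem_sdiff, Finset.mem_singleton] at hz
      obtain ⟨rfl, hz⟩ := hz
      simp [hcM, hz, hne]
    · intro Y' hY hdY
      rw [Finset.disjoint_left] at *
      constructor
      · intro z hz
        have := @hdY z
        simp only [Finset.mem_union, Finset.mem_singleton] at *
        grind
      · intro z hz
        simp only [Finset.mem_union, Finset.mem_singleton] at *
        rcases hz with hz | rfl
        · exact Or.inl (hm _ hz)
        · by_cases h : mate z ∈ B
          · exact Or.inl h
          · exact Or.inr (hY (by simp [h]))

/-! ### (a,2a), a ≤ 3 -/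

/-- `c` lies in the 2x2 square with lower left corner `(x,y)`. -/
def inSq (x y : ℤ) (c : Cell) : Prop := (c.1 = x ∨ c.1 = x + 1) ∧ (c.2 = y ∨ c.2 = y + 1)

theorem cover (X : Finset Cell) (h3 : X.card ≤ 3) :
    ∃ W : Finset Cell, W.card ≤ 2 * X.card ∧ Disjoint W X ∧
      ∀ x y, ∀ m ∈ X, inSq x y m → ∃ w ∈ W, inSq x y w := by
  by_cases hh : ∀ p ∈ X, ((p.1 + 1, p.2) : Cell) ∉ X
  · refine ⟨X.image (fun p => ((p.1 + 1, p.2) : Cell)) ∪ X.image (fun p => ((p.1 - 1, p.2) : Cell)),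
      ?_, ?_, ?_⟩
    · refine (Finset.card_union_le _ _).trans ?_
      have := Finset.card_image_le (s := X) (f := fun p => ((p.1 + 1, p.2) : Cell))
      have := Finset.card_image_le (s := X) (f := fun p => ((p.1 - 1, p.2) : Cell))
      omega
    · rw [Finset.disjoint_left]
      intro z hz hzX
      simp only [Finset.mem_union, Finset.mem_image] at hz
      rcases hz with ⟨p, hp, rfl⟩ | ⟨p, hp, rfl⟩
      · exact hh p hp hzX
      · exact hh _ hzX (by simpa using hp)
    · rintro x y ⟨u, v⟩ hm ⟨h1, h2⟩
      simp only at h1 h2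
      rcases h1 with rfl | rfl
      · exact ⟨(u + 1, v), Finset.mem_union_left _ (Finset.mem_image_of_mem _ hm), by
          simp [inSq, h2]⟩
      · refine ⟨(x + 1 - 1, v), Finset.mem_union_right _ (Finset.mem_image_of_mem _ hm), by
          simp [inSq, h2]⟩
  by_cases hv : ∀ p ∈ X, ((p.1, p.2 + 1) : Cell) ∉ X
  · refine ⟨X.image (fun p => ((p.1, p.2 + 1) : Cell)) ∪ X.image (fun p => ((p.1, p.2 - 1) : Cell)),
      ?_, ?_, ?_⟩
    · refine (Finset.card_union_le _ _).trans ?_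
      have := Finset.card_image_le (s := X) (f := fun p => ((p.1, p.2 + 1) : Cell))
      have := Finset.card_image_le (s := X) (f := fun p => ((p.1, p.2 - 1) : Cell))
      omega
    · rw [Finset.disjoint_left]
      intro z hz hzX
      simp only [Finset.mem_union, Finset.mem_image] at hz
      rcases hz with ⟨p, hp, rfl⟩ | ⟨p, hp, rfl⟩
      · exact hv p hp hzX
      · exact hv _ hzX (by simpa using hp)
    · rintro x y ⟨u, v⟩ hm ⟨h1, h2⟩
      simp only at h1 h2
      rcases h2 with rfl | rfl
      · exact ⟨(u, v + 1), Finset.mem_union_left _ (Finset.mem_image_of_mem _ hm), by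
          simp [inSq, h1]⟩
      · refine ⟨(u, y + 1 - 1), Finset.mem_union_right _ (Finset.mem_image_of_mem _ hm), by
          simp [inSq, h1]⟩
  push Not at hh hv
  obtain ⟨⟨p1, p2⟩, hp, hp'⟩ := hh
  obtain ⟨⟨q1, q2⟩, hq, hq'⟩ := hv
  simp only at hp' hq'
  -- the L-shape
  have hL : ∃ x y e f : ℤ, (e = 1 ∨ e = -1) ∧ (f = 1 ∨ f = -1) ∧
      (x, y) ∈ X ∧ (x + e, y) ∈ X ∧ (x, y + f) ∈ X := by
    by_contra hcon
    push Not at hcon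
    have hsub : ({(p1, p2), (p1 + 1, p2), (q1, q2), (q1, q2 + 1)} : Finset Cell) ⊆ X := by
      intro z hz
      simp only [Finset.mem_insert, Finset.mem_singleton] at hz
      rcases hz with rfl | rfl | rfl | rfl <;> assumption
    have hcard : ({(p1, p2), (p1 + 1, p2), (q1, q2), (q1, q2 + 1)} : Finset Cell).card = 4 := by
      have n1 : ¬ (p1 = q1 ∧ p2 = q2) := by
        rintro ⟨rfl, rfl⟩
        exact hcon p1 p2 1 1 (by simp) (by simp) hp hp' hq'
      have n2 : ¬ (p1 = q1 ∧ p2 = q2 + 1) := by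
        rintro ⟨rfl, rfl⟩
        exact hcon p1 (q2 + 1) 1 (-1) (by simp) (by simp) hp hp' (by simpa using hq)
      have n3 : ¬ (p1 + 1 = q1 ∧ p2 = q2) := by
        rintro ⟨rfl, rfl⟩
        exact hcon (p1 + 1) p2 (-1) 1 (by simp) (by simp) hp' (by simpa using hp) hq'
      have n4 : ¬ (p1 + 1 = q1 ∧ p2 = q2 + 1) := by
        rintro ⟨rfl, rfl⟩
        exact hcon (p1 + 1) (q2 + 1) (-1) (-1) (by simp) (by simp) hp' (by simpa using hp)
          (by simpa using hq)
      rw [Finset.card_insert_of_notMem, Finset.card_insert_of_notMem,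
        Finset.card_insert_of_notMem, Finset.card_singleton]
      · simp
      · simp only [Finset.mem_insert, Finset.mem_singleton, Prod.mk.injEq]; tauto
      · simp only [Finset.mem_insert, Finset.mem_singleton, Prod.mk.injEq]
        rintro (h | h | h)
        · omega
        · tauto
        · tauto
    have := Finset.card_le_card hsub
    omega
  obtain ⟨x, y, e, f, he, hf, m1, m2, m3⟩ := hL
  have hXe : X = {(x, y), (x + e, y), (x, y + f)} := by
    symm
    apply Finset.eq_of_subset_of_card_le
    · intro z hz
      simp only [Finset.mem_insert, Finset.mem_singleton] at hz
      rcases hz with rfl | rfl | rfl <;> assumption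
    · have : ({(x, y), (x + e, y), (x, y + f)} : Finset Cell).card = 3 := by
        rw [Finset.card_insert_of_notMem, Finset.card_insert_of_notMem, Finset.card_singleton]
        · simp only [Finset.mem_singleton, Prod.mk.injEq]; omega
        · simp only [Finset.mem_insert, Finset.mem_singleton, Prod.mk.injEq]; omega
      omega
  have hXc : X.card = 3 := by
    rw [hXe, Finset.card_insert_of_notMem, Finset.card_insert_of_notMem, Finset.card_singleton]
    · simp only [Finset.mem_singleton, Prod.mk.injEq]; omega
    · simp only [Finset.mem_insert, Finset.mem_singleton, Prod.mk.injEq]; omega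
  refine ⟨{(x + e, y + f), (x - e, y + f), (x, y - f), (x + 2 * e, y)}, ?_, ?_, ?_⟩
  · exact Finset.card_le_four.trans (by omega)
  · rw [hXe, Finset.disjoint_left]
    intro z hz
    simp only [Finset.mem_insert, Finset.mem_singleton] at hz ⊢
    rcases hz with rfl | rfl | rfl | rfl <;> simp only [Prod.mk.injEq] <;> omega
  · intro u v m hm hs
    rw [hXe] at hm
    simp only [Finset.mem_insert, Finset.mem_singleton, exists_eq_or_imp, exists_eq_left] at hm ⊢
    rcases hm with rfl | rfl | rfl <;> simp only [inSq] at hs ⊢ <;> omega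

theorem loser_2a (a : ℕ) (ha : a ≤ 3) : ¬ IsWinner P44 a (2 * a) := by
  apply loser_of a (2 * a) (fun M B => Disjoint M B ∧
    ∀ x y, ∀ m ∈ M, inSq x y m → ∃ w ∈ B, inSq x y w)
  · simp
  · rintro M B ⟨hd, hm⟩ hP
    obtain ⟨x, y, h1, h2, h3, h4⟩ := hasP_sq M hP
    rw [Finset.disjoint_left] at hd
    obtain ⟨⟨u, v⟩, hw, hs1, hs2⟩ := hm x y (x, y) h1 (by simp [inSq])
    simp only at hs1 hs2
    rcases hs1 with rfl | rfl <;> rcases hs2 with rfl | rfl <;> exact hd (by assumption) hw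
  · rintro M X B ⟨hd, hm⟩ hX hdX
    obtain ⟨W, w1, w2, w3⟩ := cover X (by omega)
    refine ⟨W \ (M ∪ B), (Finset.card_le_card Finset.sdiff_subset).trans (by omega), ?_, ?_⟩
    · rw [Finset.disjoint_left] at *
      intro z hz
      have := @w2 z
      simp only [Finset.mem_union, Finset.mem_sdiff] at *
      tauto
    · intro Y' hY hdY
      constructor
      · rw [Finset.disjoint_left] at *
        intro z hz
        have := @hdY z
        have := @hdX z
        have := @hd z
        simp only [Finset.mem_union] at *
        tauto
      · intro x y m hmm hs
        rcases Finset.mem_union.1 hmm with h | h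
        · obtain ⟨w, hw, hw'⟩ := hm x y m h hs
          exact ⟨w, Finset.mem_union_left _ hw, hw'⟩
        · obtain ⟨w, hw, hw'⟩ := w3 x y m h hs
          by_cases hM : w ∈ M
          · obtain ⟨w, hw, hw'⟩ := hm x y w hM hw'
            exact ⟨w, Finset.mem_union_left _ hw, hw'⟩
          by_cases hB : w ∈ B
          · exact ⟨w, Finset.mem_union_left _ hB, hw'⟩
          · exact ⟨w, Finset.mem_union_right _ (hY (by simp [hw, hM, hB])), hw'⟩

/-! ### winners -/

theorem winner4 (n b : ℕ) (hn : 4 ≤ n) : IsWinner P44 n b := by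
  apply winner_of n b 1
  obtain ⟨X, h1, h2, h3⟩ := pad_exists ∅ P44 n (by simpa [P44] using hn) (by simp)
  refine ⟨X, h2, by simpa using h3, fun Y _ _ => ?_⟩
  apply hasP_of _ 0 0 1 1 (by simp) (by simp) <;> rw [Finset.mem_union] <;> right <;> apply h1 <;>
    simp [P44]

theorem winner10 : IsWinner P44 1 0 := by
  apply winner_of 1 0 4
  refine ⟨{(0, 0)}, by simp, by simp, fun Y hY _ => ?_⟩
  obtain rfl := Finset.card_eq_zero.1 hY
  refine ⟨{(0, 1)}, by simp, by simp, fun Y hY _ => ?_⟩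
  obtain rfl := Finset.card_eq_zero.1 hY
  refine ⟨{(1, 0)}, by simp, by simp, fun Y hY _ => ?_⟩
  obtain rfl := Finset.card_eq_zero.1 hY
  refine ⟨{(1, 1)}, by simp, by simp, fun Y hY _ => ?_⟩
  obtain rfl := Finset.card_eq_zero.1 hY
  apply hasP_of _ 0 0 1 1 <;> simp

/-- sup-distance at most one -/
def near (c z : Cell) : Prop := |z.1 - c.1| ≤ 1 ∧ |z.2 - c.2| ≤ 1

/-- 3x3 blocks around cells of M are disjoint -/
def SepC (M : Finset Cell) : Prop := ∀ c ∈ M, ∀ d ∈ M, ∀ z, near c z → near d z → c = d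

noncomputable def Blk (c : Cell) : Finset Cell := Finset.Icc (c.1 - 1) (c.1 + 1) ×ˢ Finset.Icc (c.2 - 1) (c.2 + 1)

theorem mem_Blk (c z : Cell) : z ∈ Blk c ↔ near c z := by
  simp only [Blk, near, Finset.mem_product, Finset.mem_Icc, abs_le]
  omega

theorem setup_step (a : ℕ) (M B : Finset Cell) (hM : SepC M) :
    ∃ X : Finset Cell, X.card = a ∧ Disjoint X (M ∪ B) ∧ SepC (M ∪ X) := by
  obtain ⟨K, hK⟩ : ∃ K : ℤ, ∀ p ∈ M ∪ B, p.1 ≤ K := by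
    obtain ⟨K, hK⟩ := ((M ∪ B).image Prod.fst).bddAbove
    exact ⟨K, fun p hp => hK (by simpa using ⟨p.2, by simpa using hp⟩)⟩
  refine ⟨(Finset.range a).image (fun i : ℕ => ((K + 3 + 3 * i, 0) : Cell)), ?_, ?_, ?_⟩
  · rw [Finset.card_image_of_injective, Finset.card_range]
    intro i j h
    simp only [Prod.mk.injEq] at h
    omega
  · rw [Finset.disjoint_left]
    intro z hz hz'
    have := hK z hz'
    simp only [Finset.mem_image] at hz
    obtain ⟨i, -, rfl⟩ := hz
    simp only at this
    omega
  · intro c hc d hd z h1 h2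
    simp only [near, abs_le] at h1 h2
    rcases Finset.mem_union.1 hc with hc | hc <;> rcases Finset.mem_union.1 hd with hd | hd
    · exact hM c hc d hd z (by simp only [near, abs_le]; omega) (by simp only [near, abs_le]; omega)
    · have := hK c (Finset.mem_union_left _ hc)
      simp only [Finset.mem_image] at hd
      obtain ⟨i, -, rfl⟩ := hd
      simp only at h2
      omega
    · have := hK d (Finset.mem_union_left _ hd)
      simp only [Finset.mem_image] at hc
      obtain ⟨i, -, rfl⟩ := hc
      simp only at h1
      omega
    · simp only [Finset.mem_image] at hc hd
      obtain ⟨i, -, rfl⟩ := hc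
      obtain ⟨j, -, rfl⟩ := hd
      simp only at h1 h2
      have : i = j := by omega
      rw [this]

theorem setup (a b k : ℕ)
    (hfin : ∀ M B, SepC M → Disjoint M B → M.card = a * k → B.card = b * k → WinIn a b 2 M B) :
    ∀ j, j ≤ k → ∀ M B, SepC M → Disjoint M B → M.card = a * (k - j) → B.card = b * (k - j) →
      WinIn a b (j + 2) M B := by
  intro j
  induction j with
  | zero => intro _; simpa using hfin
  | succ j ih =>
    intro hj M B hS hd hM hB
    obtain ⟨X, h1, h2, h3⟩ := setup_step a M B hS
    refine ⟨X, h1, h2, fun Y hY hdY => ih (by omega) _ _ h3 ?_ ?_ ?_⟩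
    · rw [Finset.disjoint_left] at *
      intro z
      have := @hd z
      have := @h2 z
      have := @hdY z
      simp only [Finset.mem_union] at *
      tauto
    · rw [Finset.card_union_of_disjoint, hM, h1, show k - j = k - (j + 1) + 1 by omega]
      · ring
      · exact (Finset.disjoint_union_right.1 h2).1.symm
    · rw [Finset.card_union_of_disjoint, hB, hY, show k - j = k - (j + 1) + 1 by omega]
      · ring
      · exact (Finset.disjoint_union_right.1 hdY).2.symm

open Classical in
theorem many (a : ℕ) (ha : 1 ≤ a) (M B : Finset Cell) (hS : SepC M)
    (hM : M.card = a * (2 * a - 1)) (hB : B.card = (2 * a - 1) * (2 * a - 1)) :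
    ∃ T ⊆ M, T.card = a ∧ ∀ c ∈ T, (B ∩ Blk c).card ≤ 1 := by
  have hsum : ∑ c ∈ M, (B ∩ Blk c).card ≤ B.card := by
    rw [← Finset.card_biUnion]
    · apply Finset.card_le_card
      intro z hz
      simp only [Finset.mem_biUnion, Finset.mem_inter] at hz
      obtain ⟨_, _, h, _⟩ := hz
      exact h
    · intro c hc d hd hne
      simp only [Function.onFun]
      rw [Finset.disjoint_left]
      intro z hz hz'
      simp only [Finset.mem_inter, mem_Blk] at hz hz'
      exact hne (hS c hc d hd z hz.2 hz'.2)
  have hT : a ≤ (M.filter (fun c => (B ∩ Blk c).card ≤ 1)).card := by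
    by_contra hlt
    push Not at hlt
    have h1 : ∑ c ∈ M.filter (fun c => ¬ (B ∩ Blk c).card ≤ 1), 2 ≤ ∑ c ∈ M, (B ∩ Blk c).card := by
      refine le_trans ?_ (Finset.sum_le_sum_of_subset (Finset.filter_subset
        (fun c => ¬ (B ∩ Blk c).card ≤ 1) M))
      apply Finset.sum_le_sum
      intro c hc
      have := (Finset.mem_filter.1 hc).2
      omega
    rw [Finset.sum_const, smul_eq_mul] at h1
    have h2 := Finset.card_filter_add_card_filter_not (s := M) (fun c => (B ∩ Blk c).card ≤ 1)
    obtain ⟨t, rfl⟩ : ∃ t, a = t + 1 := ⟨a - 1, by omega⟩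
    rw [show 2 * (t + 1) - 1 = 2 * t + 1 by omega] at hM hB
    nlinarith
  obtain ⟨T, h1, h2⟩ := Finset.exists_subset_card_eq hT
  exact ⟨T, h1.trans (Finset.filter_subset _ _), h2, fun c hc => (Finset.mem_filter.1 (h1 hc)).2⟩

/-- direction exists: `d` unit vector, `p = (d.2, d.1)` perpendicular. -/
theorem dir_exists (B : Finset Cell) (c : Cell) (h : (B ∩ Blk c).card ≤ 1) :
    ∃ d : Cell, (d = (1, 0) ∨ d = (-1, 0) ∨ d = (0, 1) ∨ d = (0, -1)) ∧
      ∀ z ∈ B, near c z → z ≠ c → (z.1 - c.1) * d.1 + (z.2 - c.2) * d.2 < 0 := by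
  by_cases hz : ∃ z ∈ B, near c z ∧ z ≠ c
  · obtain ⟨z, hz, hn, hne⟩ := hz
    have huniq : ∀ w ∈ B, near c w → w = z := by
      intro w hw hwn
      exact Finset.card_le_one.1 h w (by simp [hw, mem_Blk, hwn]) z (by simp [hz, mem_Blk, hn])
    have hd : ∃ d : Cell, (d = (1, 0) ∨ d = (-1, 0) ∨ d = (0, 1) ∨ d = (0, -1)) ∧
        (z.1 - c.1) * d.1 + (z.2 - c.2) * d.2 < 0 := by
      have hne' : z.1 ≠ c.1 ∨ z.2 ≠ c.2 := by
        by_contra hcon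
        push Not at hcon
        exact hne (Prod.ext hcon.1 hcon.2)
      rcases hne' with h | h <;> rcases lt_or_gt_of_ne h with h | h
      · exact ⟨(1, 0), by simp, by simp; omega⟩
      · exact ⟨(-1, 0), by simp, by simp; omega⟩
      · exact ⟨(0, 1), by simp, by simp; omega⟩
      · exact ⟨(0, -1), by simp, by simp; omega⟩
    obtain ⟨d, h1, h2⟩ := hd
    refine ⟨d, h1, fun w hw hwn _ => ?_⟩
    rw [huniq w hw hwn]
    exact h2
  · push Not at hz
    exact ⟨(1, 0), by simp, fun z h1 h2 h3 => absurd (hz z h1 h2) h3⟩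

def sgn (s : Bool) : ℤ := if s then 1 else -1

/-- the threat pair at `c`, in direction `d`, on side `s`. -/
def thr (c d : Cell) (s : Bool) : Finset Cell :=
  {(c.1 + sgn s * d.2, c.2 + sgn s * d.1), (c.1 + d.1 + sgn s * d.2, c.2 + d.2 + sgn s * d.1)}

theorem attack (a : ℕ) (ha : 2 ≤ a) (M B : Finset Cell) (hS : SepC M) (hd : Disjoint M B)
    (hM : M.card = a * (2 * a - 1)) (hB : B.card = (2 * a - 1) * (2 * a - 1)) :
    WinIn a (2 * a - 1) 2 M B := by
  obtain ⟨T, hTM, hTc, hT⟩ := many a (by omega) M B hS hM hB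
  have hdir : ∀ c, ∃ d : Cell, c ∈ T → (d = (1, 0) ∨ d = (-1, 0) ∨ d = (0, 1) ∨ d = (0, -1)) ∧
      ∀ z ∈ B, near c z → z ≠ c → (z.1 - c.1) * d.1 + (z.2 - c.2) * d.2 < 0 := by
    intro c
    by_cases hc : c ∈ T
    · obtain ⟨d, h⟩ := dir_exists B c (hT c hc)
      exact ⟨d, fun _ => h⟩
    · exact ⟨0, fun h => absurd h hc⟩
  choose D hD using hdir
  have hself : ∀ c : Cell, near c c := by intro c; simp [near]
  have nearD : ∀ c ∈ T, near c (c + D c) := by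
    intro c hc
    rcases (hD c hc).1 with h | h | h | h <;> rw [h] <;> simp [near]
  have neD : ∀ c ∈ T, c + D c ≠ c := by
    intro c hc
    rcases (hD c hc).1 with h | h | h | h <;> rw [h] <;> simp
  have nearT : ∀ c ∈ T, ∀ s, ∀ z ∈ thr c (D c) s, near c z ∧ z ≠ c ∧ z ≠ c + D c ∧
      0 ≤ (z.1 - c.1) * (D c).1 + (z.2 - c.2) * (D c).2 := by
    rintro ⟨c1, c2⟩ hc s z hz
    simp only [thr, Finset.mem_insert, Finset.mem_singleton] at hz
    rcases (hD _ hc).1 with h | h | h | h <;> rw [h] at hz ⊢ <;> cases s <;>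
      rcases hz with rfl | rfl <;> simp [near, sgn]
  have thrdisj : ∀ c ∈ T, ∀ z, z ∈ thr c (D c) true → z ∈ thr c (D c) false → False := by
    rintro ⟨c1, c2⟩ hc z hz hz'
    simp only [thr, Finset.mem_insert, Finset.mem_singleton] at hz hz'
    rcases (hD _ hc).1 with h | h | h | h <;> rw [h] at hz hz' <;>
      rcases hz with rfl | rfl <;> simp [sgn] at hz' <;> omega
  have notM : ∀ c ∈ T, ∀ z, near c z → z ≠ c → z ∉ M := by
    intro c hc z h1 h2 h3
    exact h2 (hS c (hTM hc) z h3 z h1 (hself z)).symm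
  refine ⟨T.image (fun c => c + D c), ?_, ?_, ?_⟩
  · rw [Finset.card_image_of_injOn, hTc]
    intro c hc d hd h
    simp only at h
    refine hS c (hTM hc) d (hTM hd) (c + D c) (nearD c hc) ?_
    rw [h]
    exact nearD d hd
  · rw [Finset.disjoint_left]
    intro z hz
    simp only [Finset.mem_image] at hz
    obtain ⟨c, hc, rfl⟩ := hz
    simp only [Finset.mem_union, not_or]
    refine ⟨notM c hc _ (nearD c hc) (neD c hc), fun hb => ?_⟩
    have := (hD c hc).2 _ hb (nearD c hc) (neD c hc)
    rcases (hD c hc).1 with h | h | h | h <;> rw [h] at this <;> simp at this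
  · intro Y hY hdY
    -- some threat is not hit
    obtain ⟨c, hc, s, hcs⟩ : ∃ c ∈ T, ∃ s, Disjoint (thr c (D c) s) Y := by
      by_contra hcon
      push Not at hcon
      have : ∀ q : Cell × Bool, ∃ y, q.1 ∈ T → y ∈ thr q.1 (D q.1) q.2 ∧ y ∈ Y := by
        intro q
        by_cases hq : q.1 ∈ T
        · obtain ⟨y, h1, h2⟩ := Finset.not_disjoint_iff.1 (hcon q.1 hq q.2)
          exact ⟨y, fun _ => ⟨h1, h2⟩⟩
        · exact ⟨0, fun h => absurd h hq⟩
      choose g hg using this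
      have hle := Finset.card_le_card_of_injOn (s := T ×ˢ (Finset.univ : Finset Bool)) (t := Y) g
        (by
          intro q hq
          have : q.1 ∈ T := by simpa using hq
          exact (hg q this).2)
        (by
          rintro ⟨c, s⟩ hq ⟨c', s'⟩ hq' h
          have hc : c ∈ T := by simpa using hq
          have hc' : c' ∈ T := by simpa using hq'
          have g1 := (hg (c, s) hc).1
          have g2 := (hg (c', s') hc').1
          rw [← h] at g2
          simp only at g1 g2
          obtain rfl : c = c' := hS c (hTM hc) c' (hTM hc') _ (nearT c hc s _ g1).1
            (nearT c' hc' s' _ g2).1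
          have := thrdisj c hc (g (c, s))
          cases s <;> cases s' <;> first | rfl | (exfalso; tauto))
      rw [Finset.card_product, hTc, hY] at hle
      simp at hle
      omega
    obtain ⟨Z, z1, z2, z3⟩ := pad_exists (M ∪ T.image (fun c => c + D c) ∪ (B ∪ Y))
      (thr c (D c) s) a (Finset.card_le_two.trans ha) (by
        rw [Finset.disjoint_left] at hcs ⊢
        intro z hz
        obtain ⟨n1, n2, n3, n4⟩ := nearT c hc s z hz
        simp only [Finset.mem_union, not_or, Finset.mem_image, not_exists, not_and]
        refine ⟨⟨notM c hc z n1 n2, ?_⟩, ?_, hcs hz⟩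
        · rintro c' hc' rfl
          obtain rfl : c = c' := hS c (hTM hc) c' (hTM hc') _ n1 (nearD c' hc')
          exact n3 rfl
        · intro hb
          have := (hD c hc).2 z hb n1 n2
          omega)
    refine ⟨Z, z2, z3, fun Y' _ _ => ?_⟩
    have m1 : c ∈ M ∪ T.image (fun c => c + D c) ∪ Z := by simp [hTM hc]
    have m2 : c + D c ∈ M ∪ T.image (fun c => c + D c) ∪ Z :=
      Finset.mem_union_left _ (Finset.mem_union_right _
        (Finset.mem_image_of_mem (fun c => c + D c) hc))
    have m3 : ∀ z ∈ thr c (D c) s, z ∈ M ∪ T.image (fun c => c + D c) ∪ Z :=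
      fun z hz => Finset.mem_union_right _ (z1 hz)
    have m4 := m3 _ (Finset.mem_insert_self _ _)
    have m5 := m3 _ (Finset.mem_insert_of_mem (Finset.mem_singleton_self _))
    have hs : sgn s = 1 ∨ sgn s = -1 := by cases s <;> simp [sgn]
    generalize M ∪ T.image (fun c => c + D c) ∪ Z = W at m1 m2 m4 m5
    have hdd := (hD c hc).1
    generalize D c = d at m2 m4 m5 hdd
    generalize sgn s = e at m4 m5 hs
    obtain ⟨x, y⟩ := c
    show HasP W
    rcases hdd with rfl | rfl | rfl | rfl <;> simp at m2 m4 m5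
    · exact hasP_of W x y 1 e (by simp) hs m1 m4 m2 m5
    · exact hasP_of W x y (-1) (-e) (by simp) (by omega) m1 m4 m2 m5
    · exact hasP_of W x y e 1 hs (by simp) m1 m2 m4 m5
    · exact hasP_of W x y (-e) (-1) (by omega) (by simp) m1 m2 m4 m5

theorem winner_2a (a : ℕ) (ha : 2 ≤ a) : IsWinner P44 a (2 * a - 1) := by
  apply winner_of a (2 * a - 1) (2 * a - 1 + 2)
  apply setup a (2 * a - 1) (2 * a - 1) (fun M B h1 h2 h3 h4 => attack a ha M B h1 h2 h3 h4)
    (2 * a - 1) le_rfl <;> simp [SepC]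

/-- The square tetromino has threshold sequence `(0, 3, 5, ∞)`: it is a `(1,0)`-winner,
a `(1,1)`-loser, a `(2,3)`-winner, a `(2,4)`-loser, a `(3,5)`-winner, a `(3,6)`-loser,
and an `(n,b)`-winner for every `n ≥ 4` and every `b`. -/
theorem P44_threshold :
    IsWinner P44 1 0 ∧ ¬ IsWinner P44 1 1 ∧
    IsWinner P44 2 3 ∧ ¬ IsWinner P44 2 4 ∧
    IsWinner P44 3 5 ∧ ¬ IsWinner P44 3 6 ∧
    ∀ n b : ℕ, 4 ≤ n → IsWinner P44 n b :=
  ⟨winner10, loser11, winner_2a 2 (by norm_num), loser_2a 2 (by norm_num),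
    winner_2a 3 (by norm_num), loser_2a 3 (by norm_num), winner4⟩
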